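/- arXiv:1005.4943 — 6 statements merged into one kernel-verified Lean document; each statement's English description precedes it below -/
import Mathlib

section
/- Let q ≠ 0 and L > 0 be real numbers, and for real k define D_{q,L}(k) = q^2 e^{2ikL} - (ik + q)^2 e^{-2ikL}. Then for every real k one has the identity |D_{q,L}(k)|^2 = k^4 + 4q^2 (k cos(2kL) - q sin(2kL))^2. In particular |D_{q,L}(k)| ≥ k^2, so D_{q,L}(k) ≠ 0 for every real k ≠ 0. -/
open Complex

/-- The denominator `D_{q,L}(k)` in real and imaginary parts. -/
lemma double_delta_denominator_eq (q L k : ℝ) :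
    (q : ℂ) ^ 2 * Complex.exp (2 * I * k * L)
        - (I * k + q) ^ 2 * Complex.exp (-(2 * I * k * L))
      = ((k ^ 2 * Real.cos (2 * k * L) - 2 * k * q * Real.sin (2 * k * L) : ℝ) : ℂ)
        + (((2 * q ^ 2 - k ^ 2) * Real.sin (2 * k * L)
            - 2 * k * q * Real.cos (2 * k * L) : ℝ) : ℂ) * I := by
  have hpos : 2 * I * k * L = ((2 * k * L : ℝ) : ℂ) * I := by push_cast; ring
  have hneg : -(((2 * k * L : ℝ) : ℂ) * I) = ((-(2 * k * L) : ℝ) : ℂ) * I := by push_cast; ring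
  rw [hpos, hneg, exp_mul_I, exp_mul_I, ← ofReal_cos, ← ofReal_sin, ← ofReal_cos, ← ofReal_sin,
    Real.cos_neg, Real.sin_neg]
  generalize Real.cos (2 * k * L) = c
  generalize Real.sin (2 * k * L) = s
  push_cast
  linear_combination (-(k : ℂ) ^ 2 * c + k ^ 2 * s * I + 2 * k * q * s) * I_sq

/-- For the double Dirac delta potential, the denominator
`D_{q,L}(k) = q² e^{2ikL} - (ik + q)² e^{-2ikL}` satisfies
`|D_{q,L}(k)|² = k⁴ + 4q² (k cos(2kL) - q sin(2kL))²`; in particular `|D_{q,L}(k)| ≥ k²`,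
so `D_{q,L}(k) ≠ 0` for every real `k ≠ 0`. -/
theorem double_delta_denominator (q L : ℝ) (hq : q ≠ 0) (hL : 0 < L) (k : ℝ) :
    ‖(q : ℂ) ^ 2 * Complex.exp (2 * I * k * L)
        - (I * k + q) ^ 2 * Complex.exp (-(2 * I * k * L))‖ ^ 2
      = k ^ 4 + 4 * q ^ 2 * (k * Real.cos (2 * k * L) - q * Real.sin (2 * k * L)) ^ 2 ∧
    k ^ 2 ≤ ‖(q : ℂ) ^ 2 * Complex.exp (2 * I * k * L)
        - (I * k + q) ^ 2 * Complex.exp (-(2 * I * k * L))‖ ∧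
    (k ≠ 0 → (q : ℂ) ^ 2 * Complex.exp (2 * I * k * L)
        - (I * k + q) ^ 2 * Complex.exp (-(2 * I * k * L)) ≠ 0) := by
  have hnorm : ‖(q : ℂ) ^ 2 * Complex.exp (2 * I * k * L)
        - (I * k + q) ^ 2 * Complex.exp (-(2 * I * k * L))‖ ^ 2
      = k ^ 4 + 4 * q ^ 2 * (k * Real.cos (2 * k * L) - q * Real.sin (2 * k * L)) ^ 2 := by
    rw [double_delta_denominator_eq, Complex.sq_norm, normSq_add_mul_I]
    linear_combination k ^ 4 * Real.sin_sq_add_cos_sq (2 * k * L)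
  have hle : k ^ 2 ≤ ‖(q : ℂ) ^ 2 * Complex.exp (2 * I * k * L)
        - (I * k + q) ^ 2 * Complex.exp (-(2 * I * k * L))‖ := by
    refine (sq_le_sq₀ (sq_nonneg k) (norm_nonneg _)).mp ?_
    rw [hnorm, ← pow_mul]
    exact le_add_of_nonneg_right (by positivity)
  exact ⟨hnorm, hle, fun hk => norm_pos_iff.mp (lt_of_lt_of_le (by positivity) hle)⟩
end

section
/- Let q ≠ 0 and L > 0 be real numbers, and for real k ≠ 0 define t_{q,L}(k) = k^2 e^{-2ikL}/D_{q,L}(k) and r_{q,L}(k) = (q(ik-q)e^{2ikL} + q(ik+q)e^{-2ikL}) e^{-2ikL}/D_{q,L}(k), where D_{q,L}(k) = q^2 e^{2ikL} - (ik+q)^2 e^{-2ikL}. Then there exists a constant C, depending only on q and L, such that |r_{q,L}(k)| ≤ C/(1 + |k|) and |t_{q,L}(k) - 1| ≤ C/(1 + |k|) for all real k ≠ 0. -/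
open Complex

open Complex

/-- The denominator `D_{q,L}(k) = q² e^{2ikL} - (ik + q)² e^{-2ikL}` for the double Dirac
delta potential of strength `q` at `x = ±L`. -/
noncomputable def doubleDeltaD (q L k : ℝ) : ℂ :=
  (q : ℂ) ^ 2 * Complex.exp (2 * I * k * L) - (I * k + q) ^ 2 * Complex.exp (-(2 * I * k * L))

/-- Transmission coefficient `t_{q,L}(k) = k² e^{-2ikL} / D_{q,L}(k)`. -/
noncomputable def doubleDeltaT (q L k : ℝ) : ℂ :=
  (k : ℂ) ^ 2 * Complex.exp (-(2 * I * k * L)) / doubleDeltaD q L k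

/-- Reflection coefficient
`r_{q,L}(k) = (q(ik - q) e^{2ikL} + q(ik + q) e^{-2ikL}) e^{-2ikL} / D_{q,L}(k)`. -/
noncomputable def doubleDeltaR (q L k : ℝ) : ℂ :=
  ((q : ℂ) * (I * k - q) * Complex.exp (2 * I * k * L)
      + (q : ℂ) * (I * k + q) * Complex.exp (-(2 * I * k * L)))
    * Complex.exp (-(2 * I * k * L)) / doubleDeltaD q L k

theorem exp_two_I_mul (L k : ℝ) :
    Complex.exp (2 * I * k * L) = Real.cos (2 * k * L) + Real.sin (2 * k * L) * I := by
  rw [show (2 * I * k * L : ℂ) = ((2 * k * L : ℝ) : ℂ) * I by push_cast; ring,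
    Complex.exp_mul_I, ← Complex.ofReal_cos, ← Complex.ofReal_sin]

theorem exp_neg_two_I_mul (L k : ℝ) :
    Complex.exp (-(2 * I * k * L)) = Real.cos (2 * k * L) - Real.sin (2 * k * L) * I := by
  rw [show (-(2 * I * k * L) : ℂ) = ((-(2 * k * L) : ℝ) : ℂ) * I by push_cast; ring,
    Complex.exp_mul_I, ← Complex.ofReal_cos, ← Complex.ofReal_sin, Real.cos_neg, Real.sin_neg]
  push_cast
  ring

theorem norm_exp_two_I_mul (L k : ℝ) : ‖Complex.exp (2 * I * k * L)‖ = 1 := by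
  simp [Complex.norm_exp]

theorem norm_exp_neg_two_I_mul (L k : ℝ) : ‖Complex.exp (-(2 * I * k * L))‖ = 1 := by
  simp [Complex.norm_exp]

/-- Unitarity of the scattering matrix, in the form `|D|² = k⁴ + |N|²` with `i N` the numerator
of the reflection coefficient up to a phase. -/
theorem norm_doubleDeltaD_sq (q L k : ℝ) :
    ‖doubleDeltaD q L k‖ ^ 2 = (k ^ 2) ^ 2 +
      (2 * q * k * Real.cos (2 * k * L) - 2 * q ^ 2 * Real.sin (2 * k * L)) ^ 2 := by
  have hcs := Real.sin_sq_add_cos_sq (2 * k * L)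
  rw [doubleDeltaD, exp_two_I_mul, exp_neg_two_I_mul]
  generalize Real.cos (2 * k * L) = c at *
  generalize Real.sin (2 * k * L) = s at *
  have hD : (q : ℂ) ^ 2 * (c + s * I) - (I * k + q) ^ 2 * (c - s * I) =
      ((k ^ 2 * c - 2 * k * q * s : ℝ) : ℂ) +
        ((2 * q ^ 2 * s - 2 * k * q * c - k ^ 2 * s : ℝ) : ℂ) * I := by
    push_cast
    linear_combination (-(k : ℂ) ^ 2 * c + 2 * k * q * s + k ^ 2 * s * I) * Complex.I_sq
  rw [hD, ← Complex.normSq_eq_norm_sq, Complex.normSq_add_mul_I]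
  linear_combination k ^ 4 * hcs

theorem norm_doubleDeltaR (q L k : ℝ) :
    ‖doubleDeltaR q L k‖ =
      |2 * q * k * Real.cos (2 * k * L) - 2 * q ^ 2 * Real.sin (2 * k * L)| /
        ‖doubleDeltaD q L k‖ := by
  have hN : (q : ℂ) * (I * k - q) * Complex.exp (2 * I * k * L)
      + (q : ℂ) * (I * k + q) * Complex.exp (-(2 * I * k * L)) =
      ((2 * q * k * Real.cos (2 * k * L) - 2 * q ^ 2 * Real.sin (2 * k * L) : ℝ) : ℂ) * I := by
    rw [exp_two_I_mul, exp_neg_two_I_mul]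
    push_cast
    ring
  rw [doubleDeltaR, hN, norm_div, norm_mul, norm_exp_neg_two_I_mul, norm_mul, Complex.norm_I,
    Complex.norm_real, Real.norm_eq_abs, mul_one, mul_one]

theorem le_div_one_add_abs {x q k : ℝ} (hx : x ≤ 2)
    (hxk : x * k ^ 2 ≤ 2 * q ^ 2 + 2 * |q| * |k|) :
    x ≤ (4 + 4 * q ^ 2 + 4 * |q|) / (1 + |k|) := by
  have hk := abs_nonneg k
  have hq := abs_nonneg q
  rw [le_div_iff₀ (by positivity)]
  rcases le_total |k| 1 with h | h
  · nlinarith [sq_nonneg q]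
  · have hk1 : x * |k| ≤ 2 * q ^ 2 + 2 * |q| := by
      refine le_of_mul_le_mul_right ?_ (zero_lt_one.trans_le h)
      rw [← sq_abs k] at hxk
      nlinarith [mul_le_mul_of_nonneg_left h (sq_nonneg q)]
    nlinarith [sq_nonneg q]

/-- Decay of the scattering coefficients for the double Dirac delta potential: there is a
constant `C`, depending only on `q` and `L`, such that `|r_{q,L}(k)| ≤ C/(1 + |k|)` and
`|t_{q,L}(k) - 1| ≤ C/(1 + |k|)` for all real `k ≠ 0`. -/
theorem double_delta_coefficient_bounds (q L : ℝ) (hq : q ≠ 0) (hL : 0 < L) :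
    ∃ C : ℝ, ∀ k : ℝ, k ≠ 0 →
      ‖doubleDeltaR q L k‖ ≤ C / (1 + |k|) ∧
      ‖doubleDeltaT q L k - 1‖ ≤ C / (1 + |k|) := by
  refine ⟨4 + 4 * q ^ 2 + 4 * |q|, fun k hk => ?_⟩
  have hk2 : 0 < k ^ 2 := by positivity
  have hsq := norm_doubleDeltaD_sq q L k
  have hkD : k ^ 2 ≤ ‖doubleDeltaD q L k‖ :=
    le_of_sq_le_sq (by rw [hsq]; exact le_add_of_nonneg_right (sq_nonneg _)) (norm_nonneg _)
  have hD : 0 < ‖doubleDeltaD q L k‖ := hk2.trans_le hkD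
  constructor
  · have hR1 : ‖doubleDeltaR q L k‖ ≤ 1 := by
      rw [norm_doubleDeltaR, div_le_one hD]
      refine abs_le_of_sq_le_sq ?_ hD.le
      rw [hsq]
      exact le_add_of_nonneg_left (sq_nonneg _)
    refine le_div_one_add_abs (hR1.trans one_le_two) ?_
    refine (mul_le_mul_of_nonneg_left hkD (norm_nonneg _)).trans ?_
    rw [norm_doubleDeltaR, div_mul_cancel₀ _ hD.ne']
    refine (abs_sub _ _).trans ?_
    simp only [abs_mul, abs_pow, abs_two, sq_abs]
    have hc := mul_le_mul_of_nonneg_left (Real.abs_cos_le_one (2 * k * L))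
      (show 0 ≤ 2 * |q| * |k| by positivity)
    have hs := mul_le_mul_of_nonneg_left (Real.abs_sin_le_one (2 * k * L))
      (show 0 ≤ 2 * q ^ 2 by positivity)
    linarith
  · have hT1 : ‖doubleDeltaT q L k‖ ≤ 1 := by
      rw [doubleDeltaT, norm_div, norm_mul, norm_exp_neg_two_I_mul, mul_one, norm_pow,
        Complex.norm_real, Real.norm_eq_abs, sq_abs, div_le_one hD]
      exact hkD
    have hT2 : ‖doubleDeltaT q L k - 1‖ ≤ 2 := by
      refine (norm_sub_le _ _).trans ?_
      rw [norm_one]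
      linarith
    refine le_div_one_add_abs hT2 ?_
    refine (mul_le_mul_of_nonneg_left hkD (norm_nonneg _)).trans ?_
    have hTD : (doubleDeltaT q L k - 1) * doubleDeltaD q L k =
        (2 * I * k * q + q ^ 2) * Complex.exp (-(2 * I * k * L))
          - q ^ 2 * Complex.exp (2 * I * k * L) := by
      rw [sub_mul, doubleDeltaT, div_mul_cancel₀ _ (norm_pos_iff.mp hD), doubleDeltaD]
      linear_combination (k : ℂ) ^ 2 * Complex.exp (-(2 * I * k * L)) * Complex.I_sq
    rw [← norm_mul, hTD]
    refine (norm_sub_le _ _).trans ?_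
    rw [norm_mul, norm_mul, norm_exp_two_I_mul, norm_exp_neg_two_I_mul, mul_one, mul_one]
    have h := norm_add_le (2 * I * k * q : ℂ) ((q : ℂ) ^ 2)
    simp only [norm_mul, norm_pow, Complex.norm_real, Complex.norm_I, Complex.norm_ofNat,
      Real.norm_eq_abs, sq_abs, mul_one] at h ⊢
    linarith
end

section
/- Let q ≠ 0 and L > 0 be real numbers with qL ≠ 1/2, and for real k ≠ 0 define t_{q,L}(k) = k^2 e^{-2ikL}/D_{q,L}(k) with D_{q,L}(k) = q^2 e^{2ikL} - (ik+q)^2 e^{-2ikL} (nonzero for k ≠ 0). Then t_{q,L} is differentiable on ℝ \ {0} and there exists a constant C, depending only on q and L, such that |d/dk t_{q,L}(k)| ≤ C/(1 + |k|) for all real k ≠ 0. -/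
open Complex

open Complex

/-- The denominator of the transmission coefficient after cancelling `e^{-2ikL}`. -/
noncomputable def doubleDeltaF (q L k : ℝ) : ℂ :=
  (q : ℂ) ^ 2 * Complex.exp (4 * I * k * L) - (I * k + q) ^ 2

/-- The derivative of `doubleDeltaF` in `k`. -/
noncomputable def doubleDeltaF' (q L k : ℝ) : ℂ :=
  (q : ℂ) ^ 2 * (Complex.exp (4 * I * k * L) * (4 * I * L)) - 2 * (I * k + q) * I

theorem norm_exp_four_mul_I (L k : ℝ) : ‖Complex.exp (4 * I * k * L)‖ = 1 := by
  have h : (4 * I * k * L : ℂ) = ((4 * k * L : ℝ) : ℂ) * I := by push_cast; ring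
  rw [h, Complex.norm_exp_ofReal_mul_I]

theorem doubleDeltaT_eq (q L k : ℝ) : doubleDeltaT q L k = (k : ℂ) ^ 2 / doubleDeltaF q L k := by
  have h : doubleDeltaD q L k = doubleDeltaF q L k * Complex.exp (-(2 * I * k * L)) := by
    have he : Complex.exp (2 * I * k * L)
        = Complex.exp (4 * I * k * L) * Complex.exp (-(2 * I * k * L)) := by
      rw [← Complex.exp_add]; ring_nf
    rw [doubleDeltaD, doubleDeltaF, he]; ring
  rw [doubleDeltaT, h, mul_div_mul_right _ _ (Complex.exp_ne_zero _)]

theorem hasDerivAt_doubleDeltaF (q L k : ℝ) :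
    HasDerivAt (fun k : ℝ => doubleDeltaF q L k) (doubleDeltaF' q L k) k := by
  have hk : HasDerivAt (fun k : ℝ => (k : ℂ)) 1 k := Complex.ofRealCLM.hasDerivAt
  have h₁ := ((((hk.const_mul (4 * I)).mul_const (L : ℂ)).cexp).const_mul ((q : ℂ) ^ 2)).sub
    (((hk.const_mul I).add_const (q : ℂ)).pow 2)
  refine h₁.congr_deriv ?_
  simp [doubleDeltaF']

theorem sq_le_norm_doubleDeltaF (q L k : ℝ) : k ^ 2 ≤ ‖doubleDeltaF q L k‖ := by
  have h := norm_sub_norm_le ((I * k + q : ℂ) ^ 2) ((q : ℂ) ^ 2 * Complex.exp (4 * I * k * L))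
  rw [norm_sub_rev] at h
  have h₁ : ‖(I * k + q : ℂ) ^ 2‖ = k ^ 2 + q ^ 2 := by
    rw [norm_pow, ← Complex.normSq_eq_norm_sq, Complex.normSq_apply]
    simp; ring
  have h₂ : ‖(q : ℂ) ^ 2 * Complex.exp (4 * I * k * L)‖ = q ^ 2 := by
    rw [norm_mul, norm_exp_four_mul_I]; simp
  rw [h₁, h₂] at h
  unfold doubleDeltaF
  linarith

theorem norm_doubleDeltaF'_le (q L k : ℝ) :
    ‖doubleDeltaF' q L k‖ ≤ (4 * q ^ 2 * |L| + 2 * |q| + 2) * (1 + |k|) := by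
  have h := norm_sub_le ((q : ℂ) ^ 2 * (Complex.exp (4 * I * k * L) * (4 * I * L)))
    (2 * (I * k + q) * I)
  have h₁ : ‖(q : ℂ) ^ 2 * (Complex.exp (4 * I * k * L) * (4 * I * L))‖ = 4 * q ^ 2 * |L| := by
    rw [norm_mul, norm_mul, norm_exp_four_mul_I]; simp; ring
  have h₂ : ‖2 * (I * k + q : ℂ) * I‖ ≤ 2 * (|k| + |q|) := by
    have := norm_add_le (I * k : ℂ) q
    simp at this ⊢
    exact this
  have h₃ : 0 ≤ (4 * q ^ 2 * |L| + 2 * |q|) * |k| := by positivity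
  unfold doubleDeltaF'
  linarith

/-- Away from resonance `doubleDeltaF` has a simple zero at the origin and grows quadratically. -/
theorem exists_le_norm_doubleDeltaF {q L : ℝ} (hq : q ≠ 0) (hres : q * L ≠ 1 / 2) :
    ∃ c > 0, ∀ k : ℝ, c * (|k| * (1 + |k|)) ≤ ‖doubleDeltaF q L k‖ := by
  have hF' : doubleDeltaF' q L 0 ≠ 0 := by
    have h : doubleDeltaF' q L 0 = ((2 * q * (2 * (q * L) - 1) : ℝ) : ℂ) * I := by
      simp [doubleDeltaF']; ring
    rw [h]
    refine mul_ne_zero (Complex.ofReal_ne_zero.2 (mul_ne_zero (by simpa using hq) ?_)) I_ne_zero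
    intro h0
    exact hres (by linarith)
  have hF0 : doubleDeltaF q L 0 = 0 := by simp [doubleDeltaF]
  obtain ⟨A, hA, hb⟩ := ((hasDerivAt_doubleDeltaF q L 0).isTheta_sub hF').isBigO_symm.exists_pos
  have hb := hb.bound
  rw [Filter.prod_pure, Filter.eventually_map] at hb
  obtain ⟨δ, hδ, hb⟩ := Metric.eventually_nhds_iff.1 hb
  simp only [hF0, sub_zero, Real.norm_eq_abs, Real.dist_eq] at hb
  obtain ⟨c, hc, hlin⟩ : ∃ c > 0, ∀ k : ℝ, c * |k| ≤ ‖doubleDeltaF q L k‖ := by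
    refine ⟨min A⁻¹ δ, by positivity, fun k => ?_⟩
    rcases lt_or_ge |k| δ with hk | hk
    · calc min A⁻¹ δ * |k| ≤ A⁻¹ * |k| := by gcongr; exact min_le_left _ _
        _ ≤ ‖doubleDeltaF q L k‖ := by
          rw [inv_mul_le_iff₀ hA]; exact hb hk
    · calc min A⁻¹ δ * |k| ≤ |k| * |k| := by gcongr; exact (min_le_right _ _).trans hk
        _ = k ^ 2 := by rw [abs_mul_abs_self]; ring
        _ ≤ _ := sq_le_norm_doubleDeltaF q L k
  refine ⟨c / (c + 1), by positivity, fun k => ?_⟩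
  rw [div_mul_eq_mul_div, div_le_iff₀ (by positivity)]
  have h₁ := hlin k
  have h₂ := mul_le_mul_of_nonneg_left (sq_le_norm_doubleDeltaF q L k) hc.le
  rw [← sq_abs] at h₂
  linarith

theorem hasDerivAt_doubleDeltaT (q L : ℝ) {k : ℝ} (hk : k ≠ 0) :
    HasDerivAt (fun k : ℝ => doubleDeltaT q L k)
      (2 * k / doubleDeltaF q L k - k ^ 2 * doubleDeltaF' q L k / doubleDeltaF q L k ^ 2) k := by
  have hF : doubleDeltaF q L k ≠ 0 :=
    norm_pos_iff.1 ((by positivity : 0 < k ^ 2).trans_le (sq_le_norm_doubleDeltaF q L k))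
  have hk' : HasDerivAt (fun k : ℝ => (k : ℂ)) 1 k := Complex.ofRealCLM.hasDerivAt
  simp only [doubleDeltaT_eq]
  refine ((hk'.pow 2).div (hasDerivAt_doubleDeltaF q L k) hF).congr_deriv ?_
  simp
  field_simp

/-- In the non-resonant case `qL ≠ 1/2`, the transmission coefficient `t_{q,L}` of the double
Dirac delta potential is differentiable on `ℝ \ {0}`, and there is a constant `C`, depending
only on `q` and `L`, such that `|d/dk t_{q,L}(k)| ≤ C/(1 + |k|)` for all real `k ≠ 0`. -/
theorem double_delta_transmission_derivative_bound (q L : ℝ) (hq : q ≠ 0) (hL : 0 < L)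
    (hres : q * L ≠ 1 / 2) :
    (∀ k : ℝ, k ≠ 0 → DifferentiableAt ℝ (fun k : ℝ => doubleDeltaT q L k) k) ∧
    ∃ C : ℝ, ∀ k : ℝ, k ≠ 0 →
      ‖deriv (fun k : ℝ => doubleDeltaT q L k) k‖ ≤ C / (1 + |k|) := by
  refine ⟨fun k hk => (hasDerivAt_doubleDeltaT q L hk).differentiableAt, ?_⟩
  obtain ⟨c, hc, hF⟩ := exists_le_norm_doubleDeltaF hq hres
  set M := 4 * q ^ 2 * |L| + 2 * |q| + 2
  have hM0 : 0 ≤ M := by positivity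
  refine ⟨2 / c + M / c ^ 2, fun k hk => ?_⟩
  have hk0 : 0 < |k| := abs_pos.2 hk
  rw [(hasDerivAt_doubleDeltaT q L hk).deriv]
  calc ‖2 * k / doubleDeltaF q L k - k ^ 2 * doubleDeltaF' q L k / doubleDeltaF q L k ^ 2‖
      ≤ 2 * |k| / ‖doubleDeltaF q L k‖
          + |k| ^ 2 * ‖doubleDeltaF' q L k‖ / ‖doubleDeltaF q L k‖ ^ 2 := by
        refine (norm_sub_le _ _).trans_eq ?_
        simp only [norm_div, norm_mul, norm_pow, Complex.norm_real, Real.norm_eq_abs,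
          Complex.norm_ofNat]
    _ ≤ 2 * |k| / (c * (|k| * (1 + |k|)))
          + |k| ^ 2 * (M * (1 + |k|)) / (c * (|k| * (1 + |k|))) ^ 2 := by
        gcongr
        · exact hF k
        · exact norm_doubleDeltaF'_le q L k
        · exact hF k
    _ = (2 / c + M / c ^ 2) / (1 + |k|) := by
        field_simp
end

section
/- Let N ≥ 1, let k ≠ 0 be real, let q_0, …, q_{N-1} and y_0 < y_1 < … < y_{N-1} be real numbers, and let A_0, …, A_N and B_0, …, B_N be complex numbers with A_0 = 1 and B_N = 0 satisfying, for each j = 0, …, N-1, the continuity condition A_j e^{ik y_j} + B_j e^{-ik y_j} = A_{j+1} e^{ik y_j} + B_{j+1} e^{-ik y_j} and the jump condition ik[(A_{j+1} - A_j) e^{ik y_j} - (B_{j+1} - B_j) e^{-ik y_j}] = 2 q_j [A_{j+1} e^{ik y_j} + B_{j+1} e^{-ik y_j}]. Then |B_0|^2 + |A_N|^2 = 1. -/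
open Complex

/-- Conservation of the probability current across a point interaction: `a`, `b` are the values of
the right- and left-moving waves on the left of the interaction, `a'`, `b'` those on its right. -/
theorem normSq_sub_normSq_eq_of_delta_jump {k q : ℝ} (hk : k ≠ 0) {a b a' b' : ℂ}
    (hcont : a + b = a' + b')
    (hjump : I * k * ((a' - a) - (b' - b)) = 2 * q * (a' + b')) :
    normSq a - normSq b = normSq a' - normSq b' := by
  have hc_re := congrArg Complex.re hcont
  have hc_im := congrArg Complex.im hcont
  have hj_re := congrArg Complex.re hjump
  have hj_im := congrArg Complex.im hjump
  simp at hc_re hc_im hj_re hj_im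
  simp only [normSq_apply]
  apply mul_left_cancel₀ hk
  linear_combination k * (a.re - b.re) * hc_re + k * (a.im - b.im) * hc_im
    - (a'.re + b'.re) * hj_im + (a'.im + b'.im) * hj_re

/-- Multiplying amplitudes by a plane wave does not change their modulus. -/
theorem normSq_mul_exp_I_mul (a : ℂ) (t : ℝ) : normSq (a * exp (I * t)) = normSq a := by
  rw [normSq_mul, normSq_eq_norm_sq (exp _), norm_exp_I_mul_ofReal]
  simp

/-- Unitarity of the scattering matrix for a potential which is a finite sum of Dirac deltas:
if the piecewise plane-wave amplitudes `(A_j, B_j)`, `j = 0, …, N`, with `A_0 = 1` and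
`B_N = 0`, satisfy the continuity and derivative-jump conditions at each delta location `y_j`
of strength `q_j`, then `|B_0|² + |A_N|² = 1`. -/
theorem multi_delta_unitarity (N : ℕ) (hN : 1 ≤ N) (k : ℝ) (hk : k ≠ 0)
    (q y : ℕ → ℝ) (hy : ∀ j, j + 1 < N → y j < y (j + 1))
    (A B : ℕ → ℂ) (hA0 : A 0 = 1) (hBN : B N = 0)
    (hcont : ∀ j < N,
      A j * Complex.exp (I * k * y j) + B j * Complex.exp (-(I * k * y j))
        = A (j + 1) * Complex.exp (I * k * y j) + B (j + 1) * Complex.exp (-(I * k * y j)))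
    (hjump : ∀ j < N,
      I * k * ((A (j + 1) - A j) * Complex.exp (I * k * y j)
            - (B (j + 1) - B j) * Complex.exp (-(I * k * y j)))
        = 2 * q j * (A (j + 1) * Complex.exp (I * k * y j)
            + B (j + 1) * Complex.exp (-(I * k * y j)))) :
    ‖B 0‖ ^ 2 + ‖A N‖ ^ 2 = 1 := by
  have hcurrent : ∀ j ≤ N, normSq (A j) - normSq (B j) = normSq (A 0) - normSq (B 0) := by
    intro j
    induction j with
    | zero => simp
    | succ j ih =>
      intro hj
      rw [← ih (by lia)]
      have hpos (a : ℂ) : normSq (a * exp (I * k * y j)) = normSq a := by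
        simpa [mul_assoc] using normSq_mul_exp_I_mul a (k * y j)
      have hneg (a : ℂ) : normSq (a * exp (-(I * k * y j))) = normSq a := by
        simpa [mul_assoc] using normSq_mul_exp_I_mul a (-(k * y j))
      have h := normSq_sub_normSq_eq_of_delta_jump hk (hcont j hj)
        (by simpa only [sub_mul] using hjump j hj)
      simpa only [hpos, hneg] using h.symm
  have h := hcurrent N le_rfl
  simp only [hA0, hBN, normSq_one, normSq_zero] at h
  rw [← normSq_eq_norm_sq, ← normSq_eq_norm_sq]
  linarith
end

section
/- Let ε > 0 and let W : ℝ → [0, ∞) be measurable with M := ∫_ℝ (1 + |s|)^{3/2 + ε} W(s) ds < ∞. Let B be a measurable complex-valued kernel defined for x ≥ 0, z ≥ 0 satisfying |B(x,z)| ≤ ∫_{x+z}^∞ W(s) ds. Then there is a constant C depending only on ε such that for every p with 1 ≤ p ≤ ∞ and every Φ ∈ L^p((0,∞)), the operator (S_1 Φ)(x) = ∫_x^∞ B(x, (y - x)/2) Φ(y) dy is well defined for almost every x ≥ 0 and satisfies ‖S_1 Φ‖_{L^p((0,∞))} ≤ C · M · ‖Φ‖_{L^p((0,∞))}. -/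
open MeasureTheory Set
open scoped ENNReal

/-- The `L^p` norm of `g ^ (1/p)` is at most the `1/p`-th power of the integral of `g`,
including the endpoint `p = ∞`. -/
theorem eLpNorm_rpow_toReal_inv_le {α : Type*} [MeasurableSpace α] (μ : Measure α)
    {g : α → ℝ} (hg : ∀ x, 0 ≤ g x) {p : ℝ≥0∞} (hp : p ≠ 0) :
    eLpNorm (fun x => g x ^ p⁻¹.toReal) p μ ≤ (∫⁻ x, ENNReal.ofReal (g x) ∂μ) ^ p⁻¹.toReal := by
  rcases eq_or_ne p ∞ with rfl | hp'
  · simp only [ENNReal.inv_top, ENNReal.toReal_zero, Real.rpow_zero, ENNReal.rpow_zero,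
      eLpNorm_exponent_top]
    exact eLpNormEssSup_le_of_ae_enorm_bound (by simp)
  · rw [eLpNorm_eq_lintegral_rpow_enorm_toReal hp hp', ENNReal.toReal_inv, one_div]
    have hpos : 0 < p.toReal := ENNReal.toReal_pos hp hp'
    gcongr with x
    rw [Real.enorm_of_nonneg (Real.rpow_nonneg (hg x) _),
      ← ENNReal.ofReal_rpow_of_nonneg (hg x) (inv_nonneg.2 hpos.le), ← ENNReal.rpow_mul,
      inv_mul_cancel₀ hpos.ne', ENNReal.rpow_one]

/-- The tail integral of `W` decays like the weight whose moment is finite. -/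
theorem setIntegral_Ioi_le_rpow_neg_mul {W : ℝ → ℝ} {a : ℝ} (ha : 0 ≤ a) (hW : Measurable W)
    (hW0 : ∀ s, 0 ≤ W s) (hWint : Integrable (fun s => (1 + |s|) ^ a * W s)) {t : ℝ} (ht : 0 ≤ t) :
    ∫ s in Ioi t, W s ≤ (1 + t) ^ (-a) * ∫ s, (1 + |s|) ^ a * W s := by
  have hpos : 0 < (1 + t) ^ a := by positivity
  rw [Real.rpow_neg (by positivity), ← div_eq_inv_mul, le_div_iff₀' hpos, ← integral_const_mul]
  have hnn : ∀ s, 0 ≤ (1 + |s|) ^ a * W s := fun s => mul_nonneg (by positivity) (hW0 s)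
  refine le_trans ?_ (setIntegral_le_integral (s := Ioi t) hWint (ae_of_all _ hnn))
  have hle : ∀ s ∈ Ioi t, (1 + t) ^ a * W s ≤ (1 + |s|) ^ a * W s := fun s hs => by
    have := hW0 s
    have hts : t ≤ |s| := (le_of_lt hs).trans (le_abs_self s)
    gcongr
  refine setIntegral_mono_on ?_ hWint.integrableOn measurableSet_Ioi hle
  refine Integrable.mono' hWint.integrableOn (by fun_prop) ?_
  filter_upwards [ae_restrict_mem measurableSet_Ioi] with s hs
  rw [Real.norm_of_nonneg (mul_nonneg hpos.le (hW0 s))]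
  exact hle s hs

/-- For exponents `u + v = 1`, the decaying kernel `(1 + (x + y) / 2) ^ (-a)` is dominated by a
product of functions of `x` and of `y`. -/
theorem one_add_half_rpow_neg_le {a u v x y : ℝ} (ha : 0 ≤ a) (hu : 0 ≤ u) (hv : 0 ≤ v)
    (huv : u + v = 1) (hx : 0 ≤ x) (hy : 0 ≤ y) :
    (1 + (x + y) / 2) ^ (-a) ≤
      2 ^ a * (((1 + ‖x‖) ^ (-a)) ^ u * ((1 + ‖y‖) ^ (-a)) ^ v) := by
  rw [Real.norm_of_nonneg hx, Real.norm_of_nonneg hy]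
  have half : ∀ z, 0 ≤ z → z ≤ x + y → (1 + (x + y) / 2) ^ (-a) ≤ 2 ^ a * (1 + z) ^ (-a) := by
    intro z hz hzxy
    have h2 : (2 : ℝ) ^ a = (2⁻¹ : ℝ) ^ (-a) := by
      rw [Real.inv_rpow (by norm_num), Real.rpow_neg (by norm_num), inv_inv]
    rw [h2, ← Real.mul_rpow (by norm_num) (by positivity)]
    exact Real.rpow_le_rpow_of_nonpos (by positivity) (by linarith) (by linarith)
  set A := (1 + (x + y) / 2) ^ (-a)
  have hA : 0 < A := by positivity
  calc A = A ^ u * A ^ v := by rw [← Real.rpow_add hA, huv, Real.rpow_one]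
    _ ≤ (2 ^ a * (1 + x) ^ (-a)) ^ u * (2 ^ a * (1 + y) ^ (-a)) ^ v := by
      gcongr
      · exact half x hx (by linarith)
      · exact half y hy (by linarith)
    _ = ((2 ^ a) ^ u * (2 ^ a) ^ v) * (((1 + x) ^ (-a)) ^ u * ((1 + y) ^ (-a)) ^ v) := by
      rw [Real.mul_rpow (by positivity) (by positivity),
        Real.mul_rpow (by positivity) (by positivity)]
      ring
    _ = _ := by
      rw [← Real.rpow_add (x := (2 : ℝ) ^ a) (by positivity), huv, Real.rpow_one]

/-- `L^p` boundedness of the kernel operator `S_1` built from a Deift–Trubowitz type kernel: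
if `|B(x,z)| ≤ ∫_{x+z}^∞ W(s) ds` for `x, z ≥ 0`, where the nonnegative weight `W` has
`M = ∫ (1+|s|)^{3/2+ε} W(s) ds < ∞`, then there is `C = C(ε)` such that for every
`1 ≤ p ≤ ∞` and every `Φ ∈ L^p((0,∞))`, the operator
`(S_1 Φ)(x) = ∫_x^∞ B(x, (y-x)/2) Φ(y) dy` is a.e. well defined on `(0,∞)` and
`‖S_1 Φ‖_{L^p((0,∞))} ≤ C · M · ‖Φ‖_{L^p((0,∞))}`. -/
theorem S1_Lp_bound (ε : ℝ) (hε : 0 < ε) :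
    ∃ C > 0, ∀ W : ℝ → ℝ, Measurable W → (∀ s, 0 ≤ W s) →
      Integrable (fun s => (1 + |s|) ^ ((3 : ℝ) / 2 + ε) * W s) →
      ∀ B : ℝ → ℝ → ℂ, Measurable (Function.uncurry B) →
      (∀ x : ℝ, 0 ≤ x → ∀ z : ℝ, 0 ≤ z → ‖B x z‖ ≤ ∫ s in Ioi (x + z), W s) →
      ∀ p : ℝ≥0∞, 1 ≤ p → ∀ Φ : ℝ → ℂ, MemLp Φ p (volume.restrict (Ioi 0)) →
        (∀ᵐ x ∂(volume.restrict (Ioi (0 : ℝ))),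
            IntegrableOn (fun y => B x ((y - x) / 2) * Φ y) (Ioi x)) ∧
        eLpNorm (fun x => ∫ y in Ioi x, B x ((y - x) / 2) * Φ y) p (volume.restrict (Ioi 0))
          ≤ ENNReal.ofReal (C * ∫ s : ℝ, (1 + |s|) ^ ((3 : ℝ) / 2 + ε) * W s)
            * eLpNorm Φ p (volume.restrict (Ioi 0)) := by
  set a : ℝ := 3 / 2 + ε with ha_def
  have ha : 0 ≤ a := by positivity
  set g : ℝ → ℝ := fun x => (1 + ‖x‖) ^ (-a)
  have hg0 : ∀ x, 0 ≤ g x := fun x => by positivity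
  have hgm : Measurable g := by fun_prop
  have hgint : Integrable g := by
    refine integrable_one_add_norm ?_
    rw [Module.finrank_self, Nat.cast_one, ha_def]
    linarith
  have hG0 : 0 ≤ ∫ x, g x := integral_nonneg hg0
  refine ⟨2 ^ a * ((∫ x, g x) + 1), by positivity, ?_⟩
  intro W hW hW0 hWint B hB hBW p hp Φ hΦ
  set M : ℝ := ∫ s : ℝ, (1 + |s|) ^ a * W s
  have hM0 : 0 ≤ M := integral_nonneg fun s => mul_nonneg (by positivity) (hW0 s)
  set μ : Measure ℝ := volume.restrict (Ioi (0 : ℝ))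
  set G : ℝ≥0∞ := ENNReal.ofReal ((∫ x, g x) + 1) with hG
  have hGμ : ∫⁻ x, ENNReal.ofReal (g x) ∂μ ≤ G := by
    refine (setLIntegral_le_lintegral _ _).trans ?_
    rw [← ofReal_integral_eq_lintegral_ofReal hgint (ae_of_all _ hg0)]
    exact ENNReal.ofReal_le_ofReal (by linarith)
  have hG_top : G ≠ ∞ := ENNReal.ofReal_ne_top
  have hG_ne : G ≠ 0 := by
    rw [hG, Ne, ENNReal.ofReal_eq_zero, not_le]
    positivity
  set q : ℝ≥0∞ := p.conjExponent
  have hpq : p.HolderConjugate q := ENNReal.HolderConjugate.conjExponent hp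
  have hinv : p⁻¹ + q⁻¹ = 1 := hpq.inv_add_inv_eq_one
  have hp0 : p ≠ 0 := (zero_lt_one.trans_le hp).ne'
  have hq0 : q ≠ 0 := fun h => by simp [h] at hinv
  set u : ℝ := p⁻¹.toReal with hu_def
  set v : ℝ := q⁻¹.toReal with hv_def
  have huv : u + v = 1 := by
    rw [hu_def, hv_def, ← ENNReal.toReal_add (by simpa using hp0) (by simpa using hq0), hinv,
      ENNReal.toReal_one]
  have hu : 0 ≤ u := ENNReal.toReal_nonneg
  have hv : 0 ≤ v := ENNReal.toReal_nonneg
  have hgp : eLpNorm (fun x => g x ^ u) p μ ≤ G ^ u :=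
    (eLpNorm_rpow_toReal_inv_le μ hg0 hp0).trans (ENNReal.rpow_le_rpow hGμ hu)
  have hgq : eLpNorm (fun x => g x ^ v) q μ ≤ G ^ v :=
    (eLpNorm_rpow_toReal_inv_le μ hg0 hq0).trans (ENNReal.rpow_le_rpow hGμ hv)
  have hgv_mem : MemLp (fun x => g x ^ v) q μ :=
    ⟨by fun_prop, hgq.trans_lt (ENNReal.rpow_lt_top_of_nonneg hv hG_top)⟩
  have : ENNReal.HolderTriple q p 1 := hpq.symm
  set H : ℝ → ℂ := fun y => g y ^ v • Φ y with hH
  have hHint : Integrable H μ := memLp_one_iff_integrable.1 (hΦ.smul hgv_mem)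
  have hHnorm : eLpNorm H 1 μ ≤ G ^ v * eLpNorm Φ p μ :=
    (eLpNorm_smul_le_mul_eLpNorm hΦ.1 hgv_mem.1).trans (by gcongr)
  have hker : ∀ x > 0, ∀ y > x,
      ‖B x ((y - x) / 2) * Φ y‖ ≤ M * 2 ^ a * g x ^ u * ‖H y‖ := by
    intro x hx y hy
    have hy0 : 0 < y := hx.trans hy
    have h1 : ‖B x ((y - x) / 2)‖ ≤ (1 + (x + y) / 2) ^ (-a) * M := by
      refine (hBW x hx.le _ (by linarith)).trans ?_
      rw [show x + (y - x) / 2 = (x + y) / 2 by ring]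
      exact setIntegral_Ioi_le_rpow_neg_mul ha hW hW0 hWint (by positivity)
    have h2 := one_add_half_rpow_neg_le ha hu hv huv hx.le hy0.le
    rw [norm_mul, hH, norm_smul, Real.norm_of_nonneg (Real.rpow_nonneg (hg0 y) v)]
    calc ‖B x ((y - x) / 2)‖ * ‖Φ y‖ ≤ (2 ^ a * (g x ^ u * g y ^ v)) * M * ‖Φ y‖ := by
          gcongr
          exact h1.trans (by gcongr)
      _ = _ := by ring
  have hsub : ∀ x > (0 : ℝ), volume.restrict (Ioi x) ≤ μ := fun x hx =>
    Measure.restrict_mono_set _ (Ioi_subset_Ioi (le_of_lt hx))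
  have hdom : ∀ x, Integrable (fun y => M * 2 ^ a * g x ^ u * ‖H y‖) μ :=
    fun _ => hHint.norm.const_mul _
  have hpt : ∀ x > 0, ‖∫ y in Ioi x, B x ((y - x) / 2) * Φ y‖ ≤
      M * 2 ^ a * (∫ y, ‖H y‖ ∂μ) * ‖g x ^ u‖ := by
    intro x hx
    calc _ ≤ ∫ y in Ioi x, M * 2 ^ a * g x ^ u * ‖H y‖ :=
          norm_integral_le_of_norm_le ((hdom x).mono_measure (hsub x hx))
            ((ae_restrict_mem measurableSet_Ioi).mono fun y hy => hker x hx y hy)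
      _ ≤ ∫ y, M * 2 ^ a * g x ^ u * ‖H y‖ ∂μ :=
          integral_mono_measure (hsub x hx)
            (ae_of_all _ fun y => by have := hg0 x; positivity) (hdom x)
      _ = _ := by
          rw [integral_const_mul, Real.norm_of_nonneg (Real.rpow_nonneg (hg0 x) u)]
          ring
  constructor
  · filter_upwards [ae_restrict_mem measurableSet_Ioi] with x hx
    refine ((hdom x).mono_measure (hsub x hx)).mono' ?_
      ((ae_restrict_mem measurableSet_Ioi).mono fun y hy => hker x hx y hy)
    have hBx : Measurable fun y => B x ((y - x) / 2) :=
      hB.comp (measurable_const.prodMk ((measurable_id.sub_const x).div_const 2))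
    exact hBx.aestronglyMeasurable.mul (hΦ.1.mono_measure (hsub x hx))
  · have hHI : ENNReal.ofReal (∫ y, ‖H y‖ ∂μ) = eLpNorm H 1 μ := by
      rw [eLpNorm_one_eq_lintegral_enorm, ofReal_integral_norm_eq_lintegral_enorm hHint]
    calc _ ≤ ENNReal.ofReal (M * 2 ^ a * ∫ y, ‖H y‖ ∂μ) * eLpNorm (fun x => g x ^ u) p μ :=
          eLpNorm_le_mul_eLpNorm_of_ae_le_mul
            ((ae_restrict_mem measurableSet_Ioi).mono fun x hx => hpt x hx) p
      _ ≤ ENNReal.ofReal (M * 2 ^ a) * (G ^ v * eLpNorm Φ p μ) * G ^ u := by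
          rw [ENNReal.ofReal_mul (by positivity), hHI]
          gcongr
      _ = ENNReal.ofReal (M * 2 ^ a) * (G ^ u * G ^ v) * eLpNorm Φ p μ := by ring
      _ = _ := by
          rw [← ENNReal.rpow_add _ _ hG_ne hG_top, huv, ENNReal.rpow_one, hG,
            ← ENNReal.ofReal_mul (by positivity)]
          congr 2
          ring
end

section
/- Let ε > 0 and let W : ℝ → [0, ∞) be measurable with M := ∫_ℝ (1 + |s|)^{3/2 + ε} W(s) ds < ∞. Let B̃ be a measurable complex-valued kernel defined for x ≥ 0, z ≥ 0 satisfying |B̃(x,z)| ≤ W(x + z) + ∫_{x+z}^∞ W(s) ds. Then there is a constant C depending only on ε such that for every p with 1 ≤ p ≤ ∞ and every Φ ∈ L^p((0,∞)), the function x ↦ ∫_x^∞ B̃(x, (y - x)/2) Φ(y) dy is defined for almost every x ≥ 0 and its L^p((0,∞)) norm is at most C · M · ‖Φ‖_{L^p((0,∞))}. -/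
open MeasureTheory Set
open scoped ENNReal

/-- **Schur test**, in `ℝ≥0∞`: a kernel whose row and column integrals are at most `A` acts on
`L^p` with norm at most `A`. -/
theorem eLpNorm_lintegral_mul_le_of_schur {α β : Type*} [MeasurableSpace α] [MeasurableSpace β]
    {μ : Measure α} {ν : Measure β} [SFinite μ] [SFinite ν] {k : α → β → ℝ≥0∞}
    (hk : Measurable (Function.uncurry k)) {A : ℝ≥0∞}
    (hrow : ∀ᵐ x ∂μ, ∫⁻ y, k x y ∂ν ≤ A) (hcol : ∀ᵐ y ∂ν, ∫⁻ x, k x y ∂μ ≤ A)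
    {p : ℝ≥0∞} (hp : 1 ≤ p) {g : β → ℝ≥0∞} (hg : AEMeasurable g ν) :
    eLpNorm (fun x => ∫⁻ y, k x y * g y ∂ν) p μ ≤ A * eLpNorm g p ν := by
  obtain rfl | hp_top := eq_or_ne p ∞
  · simp only [eLpNorm_exponent_top]
    refine essSup_le_of_ae_le _ ?_
    filter_upwards [hrow] with x hx
    rw [enorm_eq_self]
    calc ∫⁻ y, k x y * g y ∂ν ≤ ∫⁻ y, k x y * eLpNormEssSup g ν ∂ν := by
          refine lintegral_mono_ae ?_
          filter_upwards [enorm_ae_le_eLpNormEssSup g ν] with y hy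
          rw [enorm_eq_self] at hy
          gcongr
      _ = (∫⁻ y, k x y ∂ν) * eLpNormEssSup g ν :=
          lintegral_mul_const _ (hk.comp measurable_prodMk_left)
      _ ≤ A * eLpNormEssSup g ν := by gcongr
  have hp0 : p ≠ 0 := (zero_lt_one.trans_le hp).ne'
  have hr : 1 ≤ p.toReal := by
    simpa using (ENNReal.toReal_le_toReal ENNReal.one_ne_top hp_top).2 hp
  simp only [eLpNorm_eq_lintegral_rpow_enorm_toReal hp0 hp_top, enorm_eq_self]
  set r := p.toReal
  have hr0 : 0 < r := zero_lt_one.trans_le hr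
  have hpoint : ∀ᵐ x ∂μ,
      (∫⁻ y, k x y * g y ∂ν) ^ r ≤ A ^ (r - 1) * ∫⁻ y, k x y * g y ^ r ∂ν := by
    filter_upwards [hrow] with x hx
    have hkx : Measurable (k x) := hk.comp measurable_prodMk_left
    have hac := withDensity_absolutelyContinuous ν (k x)
    have hJ := eLpNorm'_le_eLpNorm'_mul_rpow_measure_univ (μ := ν.withDensity (k x)) one_pos hr
      (hg.mono_ac hac).aestronglyMeasurable
    simp only [eLpNorm'_eq_lintegral_enorm, enorm_eq_self, ENNReal.rpow_one, div_one] at hJ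
    rw [lintegral_withDensity_eq_lintegral_mul₀ hkx.aemeasurable hg,
      lintegral_withDensity_eq_lintegral_mul₀ hkx.aemeasurable (hg.pow_const r),
      withDensity_apply _ MeasurableSet.univ, Measure.restrict_univ] at hJ
    simp only [Pi.mul_apply] at hJ
    calc (∫⁻ y, k x y * g y ∂ν) ^ r
        ≤ ((∫⁻ y, k x y * g y ^ r ∂ν) ^ (1 / r) * (∫⁻ y, k x y ∂ν) ^ (1 - 1 / r)) ^ r := by
          gcongr
      _ = (∫⁻ y, k x y ∂ν) ^ (r - 1) * ∫⁻ y, k x y * g y ^ r ∂ν := by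
          rw [ENNReal.mul_rpow_of_nonneg _ _ hr0.le, ← ENNReal.rpow_mul, ← ENNReal.rpow_mul,
            one_div_mul_cancel hr0.ne', ENNReal.rpow_one, mul_comm, sub_mul, one_mul,
            one_div_mul_cancel hr0.ne']
      _ ≤ A ^ (r - 1) * ∫⁻ y, k x y * g y ^ r ∂ν := by
          gcongr
  have hmeas : AEMeasurable (Function.uncurry fun x y => k x y * g y ^ r) (μ.prod ν) :=
    hk.aemeasurable.mul (hg.comp_snd.pow_const r)
  calc (∫⁻ x, (∫⁻ y, k x y * g y ∂ν) ^ r ∂μ) ^ (1 / r)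
      ≤ (∫⁻ x, A ^ (r - 1) * ∫⁻ y, k x y * g y ^ r ∂ν ∂μ) ^ (1 / r) := by
        gcongr ?_ ^ _
        exact lintegral_mono_ae hpoint
    _ = (A ^ (r - 1) * ∫⁻ y, (∫⁻ x, k x y ∂μ) * g y ^ r ∂ν) ^ (1 / r) := by
        have hrows : AEMeasurable (fun x => ∫⁻ y, k x y * g y ^ r ∂ν) μ :=
          hmeas.lintegral_prod_right'
        rw [lintegral_const_mul'' _ hrows, lintegral_lintegral_swap hmeas]
        congr 2
        exact lintegral_congr fun y => lintegral_mul_const _ (hk.comp measurable_prodMk_right)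
    _ ≤ (A ^ (r - 1) * ∫⁻ y, A * g y ^ r ∂ν) ^ (1 / r) := by
        gcongr ?_ ^ _
        gcongr _ * ?_
        refine lintegral_mono_ae ?_
        filter_upwards [hcol] with y hy
        gcongr
    _ = (A ^ r * ∫⁻ y, g y ^ r ∂ν) ^ (1 / r) := by
        rw [lintegral_const_mul'' _ (hg.pow_const r), ← mul_assoc]
        congr 2
        nth_rw 2 [← ENNReal.rpow_one A]
        rw [← ENNReal.rpow_add_of_nonneg _ _ (by linarith) zero_le_one, sub_add_cancel]
    _ = A * (∫⁻ y, g y ^ r ∂ν) ^ (1 / r) := by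
        rw [ENNReal.mul_rpow_of_nonneg _ _ (by positivity), ← ENNReal.rpow_mul,
          mul_one_div_cancel hr0.ne', ENNReal.rpow_one]

theorem ae_lt_top_of_eLpNorm_lt_top {α : Type*} [MeasurableSpace α] {μ : Measure α}
    {f : α → ℝ≥0∞} (hf : AEMeasurable f μ) {p : ℝ≥0∞} (hp : p ≠ 0) (h : eLpNorm f p μ < ∞) :
    ∀ᵐ x ∂μ, f x < ∞ := by
  obtain rfl | hp_top := eq_or_ne p ∞
  · rw [eLpNorm_exponent_top] at h
    filter_upwards [enorm_ae_le_eLpNormEssSup f μ] with x hx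
    exact hx.trans_lt h
  · have h' := lintegral_rpow_enorm_lt_top_of_eLpNorm_lt_top hp hp_top h
    filter_upwards [ae_lt_top' (hf.enorm.pow_const _) h'.ne] with x hx
    simpa using (ENNReal.rpow_lt_top_iff_of_pos (ENNReal.toReal_pos hp hp_top)).1 hx

theorem lintegral_comp_div_two (f : ℝ → ℝ≥0∞) (hf : Measurable f) :
    ∫⁻ x, f (x / 2) = 2 * ∫⁻ x, f x := by
  have hmap : Measure.map (fun x : ℝ => x * 2⁻¹) volume = (2 : ℝ≥0∞) • volume := by
    rw [Real.map_volume_mul_right (by norm_num)]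
    norm_num
  simp_rw [div_eq_mul_inv]
  rw [← lintegral_map (g := fun x : ℝ => x * 2⁻¹) hf (measurable_id.mul_const _), hmap, lintegral_smul_measure, smul_eq_mul]

theorem setLIntegral_Ioi_comp_midpoint_le {f : ℝ → ℝ≥0∞} (hf : Measurable f) {c : ℝ}
    (hc : 0 ≤ c) :
    ∫⁻ x in Ioi 0, f ((x + c) / 2) ≤ 2 * ∫⁻ x in Ioi 0, f x := by
  have hF : Measurable ((Ioi 0).indicator f) := hf.indicator measurableSet_Ioi
  calc ∫⁻ x in Ioi 0, f ((x + c) / 2)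
      = ∫⁻ x, (Ioi 0).indicator (fun x => f ((x + c) / 2)) x :=
        (lintegral_indicator measurableSet_Ioi _).symm
    _ ≤ ∫⁻ x, (Ioi 0).indicator f ((x + c) / 2) := by
        refine lintegral_mono fun x => ?_
        by_cases hx : 0 < x
        · have : 0 < (x + c) / 2 := by positivity
          simp [hx, this]
        · simp [hx]
    _ = ∫⁻ x, (Ioi 0).indicator f (x / 2) :=
        lintegral_add_right_eq_self (fun x => (Ioi 0).indicator f (x / 2)) c
    _ = 2 * ∫⁻ x in Ioi 0, f x := by
        rw [lintegral_comp_div_two _ hF, lintegral_indicator measurableSet_Ioi]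

theorem measurable_setLIntegral_Ioi (w : ℝ → ℝ≥0∞) :
    Measurable fun t : ℝ => ∫⁻ s in Ioi t, w s :=
  Antitone.measurable fun _ _ h => lintegral_mono_set (Ioi_subset_Ioi h)

theorem setLIntegral_Ioi_setLIntegral_Ioi {w : ℝ → ℝ≥0∞} (hw : Measurable w) :
    ∫⁻ t in Ioi 0, ∫⁻ s in Ioi t, w s = ∫⁻ s in Ioi 0, ENNReal.ofReal s * w s := by
  have hmeas : Measurable (Function.uncurry fun t s : ℝ => (Ioi t).indicator w s) := by
    have : (Function.uncurry fun t s : ℝ => (Ioi t).indicator w s)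
        = {q : ℝ × ℝ | q.1 < q.2}.indicator (fun q => w q.2) := by
      ext ⟨t, s⟩
      simp [indicator_apply]
    rw [this]
    exact (hw.comp measurable_snd).indicator (measurableSet_lt measurable_fst measurable_snd)
  simp_rw [← lintegral_indicator measurableSet_Ioi w]
  rw [lintegral_lintegral_swap hmeas.aemeasurable,
    ← lintegral_indicator measurableSet_Ioi (fun s => ENNReal.ofReal s * w s)]
  refine lintegral_congr fun s => ?_
  have : (fun t : ℝ => (Ioi t).indicator w s) = (Iio s).indicator fun _ => w s := by
    ext t
    simp [indicator_apply]
  rw [this, lintegral_indicator_const measurableSet_Iio, Measure.restrict_apply measurableSet_Iio,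
    Iio_inter_Ioi, Real.volume_Ioo, sub_zero]
  by_cases hs : 0 < s
  · simp [hs, mul_comm]
  · simp [hs, ENNReal.ofReal_of_nonpos (not_lt.1 hs)]

/-- `L^p` bound for the derivative kernel: if `|B̃(x,z)| ≤ W(x+z) + ∫_{x+z}^∞ W(s) ds` for
`x, z ≥ 0`, where the nonnegative weight `W` has `M = ∫ (1+|s|)^{3/2+ε} W(s) ds < ∞`, then
there is `C = C(ε)` such that for every `1 ≤ p ≤ ∞` and every `Φ ∈ L^p((0,∞))`, the
function `x ↦ ∫_x^∞ B̃(x, (y-x)/2) Φ(y) dy` is a.e. defined on `(0,∞)` with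
`L^p((0,∞))` norm at most `C · M · ‖Φ‖_{L^p((0,∞))}`. -/
theorem derivative_kernel_Lp_bound (ε : ℝ) (hε : 0 < ε) :
    ∃ C > 0, ∀ W : ℝ → ℝ, Measurable W → (∀ s, 0 ≤ W s) →
      Integrable (fun s => (1 + |s|) ^ ((3 : ℝ) / 2 + ε) * W s) →
      ∀ B : ℝ → ℝ → ℂ, Measurable (Function.uncurry B) →
      (∀ x : ℝ, 0 ≤ x → ∀ z : ℝ, 0 ≤ z →
        ‖B x z‖ ≤ W (x + z) + ∫ s in Ioi (x + z), W s) →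
      ∀ p : ℝ≥0∞, 1 ≤ p → ∀ Φ : ℝ → ℂ, MemLp Φ p (volume.restrict (Ioi 0)) →
        (∀ᵐ x ∂(volume.restrict (Ioi (0 : ℝ))),
            IntegrableOn (fun y => B x ((y - x) / 2) * Φ y) (Ioi x)) ∧
        eLpNorm (fun x => ∫ y in Ioi x, B x ((y - x) / 2) * Φ y) p (volume.restrict (Ioi 0))
          ≤ ENNReal.ofReal (C * ∫ s : ℝ, (1 + |s|) ^ ((3 : ℝ) / 2 + ε) * W s)
            * eLpNorm Φ p (volume.restrict (Ioi 0)) := by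
  refine ⟨2, two_pos, fun W hW hW0 hWint B hB hBW p hp Φ hΦ => ?_⟩
  set M := ∫ s : ℝ, (1 + |s|) ^ ((3 : ℝ) / 2 + ε) * W s
  set w : ℝ → ℝ≥0∞ := fun s => ENNReal.ofReal (W s)
  have hw : Measurable w := hW.ennreal_ofReal
  have hle : ∀ s : ℝ, 1 + |s| ≤ (1 + |s|) ^ ((3 : ℝ) / 2 + ε) := fun s =>
    Real.self_le_rpow_of_one_le (by linarith [abs_nonneg s]) (by linarith)
  have hWi : Integrable W := by
    refine hWint.mono' hW.aestronglyMeasurable (Filter.Eventually.of_forall fun s => ?_)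
    rw [Real.norm_of_nonneg (hW0 s)]
    exact le_mul_of_one_le_left (hW0 s) (by linarith [abs_nonneg s, hle s])
  set h : ℝ → ℝ≥0∞ := fun t => w t + ∫⁻ s in Ioi t, w s
  have hh : Measurable h := hw.add (measurable_setLIntegral_Ioi w)
  have hhM : ∫⁻ t in Ioi 0, h t ≤ ENNReal.ofReal M := by
    rw [lintegral_add_left hw, setLIntegral_Ioi_setLIntegral_Ioi hw, ← lintegral_add_left hw,
      ofReal_integral_eq_lintegral_ofReal hWint
        (Filter.Eventually.of_forall fun s => mul_nonneg (by positivity) (hW0 s))]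
    refine (setLIntegral_mono' measurableSet_Ioi fun s hs => ?_).trans (setLIntegral_le_lintegral _ _)
    have hs0 : (0 : ℝ) < s := hs
    rw [← ENNReal.ofReal_mul hs0.le, ← ENNReal.ofReal_add (hW0 s) (mul_nonneg hs0.le (hW0 s))]
    refine ENNReal.ofReal_le_ofReal ?_
    have := mul_le_mul_of_nonneg_right (hle s) (hW0 s)
    rw [abs_of_pos hs0] at this ⊢
    linarith
  have hsum : ∀ c : ℝ, 0 ≤ c → ∫⁻ x in Ioi 0, h ((x + c) / 2) ≤ ENNReal.ofReal (2 * M) := by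
    intro c hc
    refine (setLIntegral_Ioi_comp_midpoint_le hh hc).trans ?_
    rw [ENNReal.ofReal_mul two_pos.le, ENNReal.ofReal_ofNat]
    gcongr
  have hk : Measurable (Function.uncurry fun x y : ℝ => h ((x + y) / 2)) :=
    hh.comp ((measurable_fst.add measurable_snd).div_const 2)
  set F : ℝ → ℝ≥0∞ := fun x => ∫⁻ y in Ioi 0, h ((x + y) / 2) * ‖Φ y‖ₑ
  have hΦm : AEMeasurable (fun y => ‖Φ y‖ₑ) (volume.restrict (Ioi 0)) := hΦ.1.enorm
  have hF : eLpNorm F p (volume.restrict (Ioi 0))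
      ≤ ENNReal.ofReal (2 * M) * eLpNorm Φ p (volume.restrict (Ioi 0)) := by
    have := eLpNorm_lintegral_mul_le_of_schur (A := ENNReal.ofReal (2 * M)) hk
      ((ae_restrict_mem measurableSet_Ioi).mono fun x (hx : 0 < x) => by
        simpa only [add_comm] using hsum x hx.le)
      ((ae_restrict_mem measurableSet_Ioi).mono fun y (hy : 0 < y) => hsum y hy.le) hp hΦm
    rwa [eLpNorm_enorm] at this
  have hFm : AEMeasurable F (volume.restrict (Ioi 0)) :=
    AEMeasurable.lintegral_prod_right' (hk.aemeasurable.mul hΦm.comp_snd)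
  have hFfin : ∀ᵐ x ∂(volume.restrict (Ioi (0 : ℝ))), F x < ∞ :=
    ae_lt_top_of_eLpNorm_lt_top hFm (zero_lt_one.trans_le hp).ne'
      (hF.trans_lt (ENNReal.mul_lt_top ENNReal.ofReal_lt_top hΦ.2))
  have hBh : ∀ x : ℝ, 0 < x → ∀ y : ℝ, x < y → ‖B x ((y - x) / 2)‖ₑ ≤ h ((x + y) / 2) := by
    intro x hx y hxy
    have hb := hBW x hx.le ((y - x) / 2) (by linarith)
    rw [show x + (y - x) / 2 = (x + y) / 2 by ring] at hb
    rw [← ofReal_norm]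
    refine (ENNReal.ofReal_le_ofReal hb).trans ?_
    rw [ENNReal.ofReal_add (hW0 _) (integral_nonneg hW0),
      ofReal_integral_eq_lintegral_ofReal hWi.integrableOn (Filter.Eventually.of_forall hW0)]
  have hbound : ∀ x : ℝ, 0 < x →
      ∫⁻ y in Ioi x, ‖B x ((y - x) / 2) * Φ y‖ₑ ≤ F x := by
    intro x hx
    calc ∫⁻ y in Ioi x, ‖B x ((y - x) / 2) * Φ y‖ₑ
        ≤ ∫⁻ y in Ioi x, h ((x + y) / 2) * ‖Φ y‖ₑ := by
          refine setLIntegral_mono' measurableSet_Ioi fun y hy => ?_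
          rw [enorm_mul]
          gcongr
          exact hBh x hx y hy
      _ ≤ F x := lintegral_mono_set (Ioi_subset_Ioi hx.le)
  constructor
  · filter_upwards [hFfin, ae_restrict_mem measurableSet_Ioi] with x hx (hx0 : 0 < x)
    have hBx : Measurable fun y => B x ((y - x) / 2) :=
      hB.comp (measurable_const.prodMk ((measurable_id.sub_const x).div_const 2))
    exact ⟨hBx.aestronglyMeasurable.mul
      (hΦ.1.mono_measure (Measure.restrict_mono (Ioi_subset_Ioi hx0.le) le_rfl)),
      (hbound x hx0).trans_lt hx⟩
  · refine (eLpNorm_mono_enorm_ae ?_).trans hF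
    filter_upwards [ae_restrict_mem measurableSet_Ioi] with x (hx0 : 0 < x)
    exact (enorm_integral_le_lintegral_enorm _).trans (hbound x hx0)
end
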